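/- Let α_1, α_2, α_3 ∈ ℝ with α_3 > 0, α_1 > −1, α_2 > −1, and let n ∈ ℕ_0 satisfy 2n < α_3 − α_1 − α_2 − 1. Define R_n(x) = Σ_{k=0}^n [(−n)_k (n − α_3 + α_1 + α_2 + 1)_k / ((α_1+1)_k (α_2+1)_k)] · (−x)_k / k! and W(x) = (α_1+1)_x (α_2+1)_x / (x! (α_3+1)_x) for x ∈ ℕ_0. Then the series Σ_{x=0}^∞ R_n(x)² W(x) converges and equals [n! / ((α_3−α_1−α_2−2n−1)(1+α_1)_n (1+α_2)_n)] · [Γ(α_3−α_1−α_2−n) Γ(α_3+1) / (Γ(α_3−α_1−n) Γ(α_3−α_2−n))]. -/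

import Mathlib

open Finset

/-- Pochhammer symbol `(a)_k = a(a+1)⋯(a+k−1)`. -/
noncomputable def poch (a : ℝ) (k : ℕ) : ℝ := ∏ i ∈ Finset.range k, (a + i)

/-- The polynomials `R_n` of (4.10). -/
noncomputable def Rpol (α₁ α₂ α₃ : ℝ) (n : ℕ) (x : ℝ) : ℝ :=
  ∑ k ∈ Finset.range (n + 1),
    poch (-(n : ℝ)) k * poch ((n : ℝ) - α₃ + α₁ + α₂ + 1) k
      / (poch (α₁ + 1) k * poch (α₂ + 1) k) * poch (-x) k / (Nat.factorial k : ℝ)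

/-- The weight `W(x) = (α₁+1)_x (α₂+1)_x / (x! (α₃+1)_x)` on `ℕ₀`. -/
noncomputable def Wt (α₁ α₂ α₃ : ℝ) (x : ℕ) : ℝ :=
  poch (α₁ + 1) x * poch (α₂ + 1) x / ((Nat.factorial x : ℝ) * poch (α₃ + 1) x)

open Filter Topology

lemma poch_zero (a : ℝ) : poch a 0 = 1 := by simp [poch]

lemma poch_succ (a : ℝ) (k : ℕ) : poch a (k + 1) = poch a k * (a + k) := by
  simp [poch, prod_range_succ]

lemma poch_add (a : ℝ) (m k : ℕ) : poch a (m + k) = poch a m * poch (a + m) k := by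
  simp [poch, prod_range_add, add_assoc]

lemma poch_succ' (a : ℝ) (k : ℕ) : poch a (k + 1) = a * poch (a + 1) k := by
  rw [add_comm, poch_add, poch_succ, poch_zero]; simp

lemma poch_pos {a : ℝ} (ha : 0 < a) (k : ℕ) : 0 < poch a k :=
  prod_pos fun i _ => by positivity

lemma poch_neg (a : ℝ) (k : ℕ) : poch (-a) k = (-1) ^ k * ∏ i ∈ range k, (a - i) := by
  induction k with
  | zero => simp [poch]
  | succ k ih => rw [poch_succ, ih, prod_range_succ]; ring

lemma poch_neg_natCast_of_lt {m k : ℕ} (h : m < k) : poch (-(m : ℝ)) k = 0 :=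
  prod_eq_zero (mem_range.2 h) (by simp)

lemma poch_neg_natCast_add (x k : ℕ) :
    poch (-((x + k : ℕ) : ℝ)) k = (-1) ^ k * ((x + k).factorial / x.factorial) := by
  induction k with
  | zero => simp [poch, Nat.factorial_ne_zero]
  | succ k ih =>
    rw [poch_succ', show -((x + (k + 1) : ℕ) : ℝ) + 1 = -((x + k : ℕ) : ℝ) by push_cast; ring,
      ih, ← add_assoc, Nat.factorial_succ]
    push_cast; ring

lemma poch_neg_natCast {n k : ℕ} (h : k ≤ n) :
    poch (-(n : ℝ)) k = (-1) ^ k * n.choose k * k.factorial := by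
  obtain ⟨x, rfl⟩ := Nat.exists_eq_add_of_le' h
  rw [poch_neg_natCast_add, add_comm x k, Nat.cast_add_choose]
  field_simp

lemma Gamma_add_natCast {a : ℝ} (ha : 0 < a) (k : ℕ) :
    Real.Gamma (a + k) = Real.Gamma a * poch a k := by
  induction k with
  | zero => simp [poch]
  | succ k ih =>
    rw [Nat.cast_succ, ← add_assoc, Real.Gamma_add_one (by positivity), ih, poch_succ]; ring

lemma poch_eq_GammaSeq {a : ℝ} (ha : 0 < a) (n : ℕ) (hn : 0 < n) :
    poch a (n + 1) = (n : ℝ) ^ a * n.factorial / Real.GammaSeq a n := by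
  have h : (n : ℝ) ^ a * n.factorial ≠ 0 := by positivity
  have := (poch_pos ha (n + 1)).ne'
  rw [Real.GammaSeq, ← poch]
  field_simp

/-- The summand of the hypergeometric series `₂F₁(a, b; c; 1)`. -/
noncomputable def gaussTerm (a b c : ℝ) (x : ℕ) : ℝ :=
  poch a x * poch b x / (x.factorial * poch c x)

lemma gaussTerm_zero (a b c : ℝ) : gaussTerm a b c 0 = 1 := by simp [gaussTerm, poch]

lemma gaussTerm_pos {a b c : ℝ} (ha : 0 < a) (hb : 0 < b) (hc : 0 < c) (x : ℕ) :
    0 < gaussTerm a b c x := by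
  have := poch_pos ha x
  have := poch_pos hb x
  have := poch_pos hc x
  unfold gaussTerm; positivity

lemma gaussTerm_succ_eq {a b c : ℝ} (ha : 0 < a) (hb : 0 < b) (hc : 0 < c) (n : ℕ) (hn : 0 < n) :
    (n + 1) * gaussTerm a b c (n + 1) = (n : ℝ) ^ (-(c - a - b)) *
      (Real.GammaSeq c n / (Real.GammaSeq a n * Real.GammaSeq b n)) := by
  have hn' : (0 : ℝ) < n := by exact_mod_cast hn
  have e : (n : ℝ) ^ (-(c - a - b)) = (n : ℝ) ^ a * (n : ℝ) ^ b / (n : ℝ) ^ c := by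
    rw [← Real.rpow_add hn', ← Real.rpow_sub hn']; congr 1; ring
  have := (Real.rpow_pos_of_pos hn' c).ne'
  rw [gaussTerm, poch_eq_GammaSeq ha n hn, poch_eq_GammaSeq hb n hn, poch_eq_GammaSeq hc n hn, e,
    Nat.factorial_succ]
  push_cast
  field_simp

lemma tendsto_gaussTerm_ratio {a b c : ℝ} (ha : 0 < a) (hb : 0 < b) :
    Tendsto (fun n => Real.GammaSeq c n / (Real.GammaSeq a n * Real.GammaSeq b n)) atTop
      (𝓝 (Real.Gamma c / (Real.Gamma a * Real.Gamma b))) :=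
  (Real.GammaSeq_tendsto_Gamma c).div
    ((Real.GammaSeq_tendsto_Gamma a).mul (Real.GammaSeq_tendsto_Gamma b))
    (mul_pos (Real.Gamma_pos_of_pos ha) (Real.Gamma_pos_of_pos hb)).ne'

lemma tendsto_mul_gaussTerm {a b c : ℝ} (ha : 0 < a) (hb : 0 < b) (h : a + b < c) :
    Tendsto (fun n : ℕ => (n : ℝ) * gaussTerm a b c n) atTop (𝓝 0) := by
  rw [← tendsto_add_atTop_iff_nat 1]
  have h1 : Tendsto (fun n : ℕ => (n : ℝ) ^ (-(c - a - b))) atTop (𝓝 0) :=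
    (tendsto_rpow_neg_atTop (by linarith)).comp tendsto_natCast_atTop_atTop
  have h2 := h1.mul (tendsto_gaussTerm_ratio (c := c) ha hb)
  rw [zero_mul] at h2
  refine h2.congr' ?_
  filter_upwards [eventually_gt_atTop 0] with n hn
  rw [← gaussTerm_succ_eq ha hb (by linarith) n hn]
  push_cast; ring

lemma summable_gaussTerm {a b c : ℝ} (ha : 0 < a) (hb : 0 < b) (h : a + b < c) :
    Summable (gaussTerm a b c) := by
  rw [← summable_nat_add_iff 1]
  have hs : Summable fun n : ℕ => (n : ℝ) ^ (-(c - a - b) - 1) :=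
    Real.summable_nat_rpow.2 (by linarith)
  refine summable_of_isBigO_nat hs ?_
  have h1 := (Asymptotics.isBigO_refl (fun n : ℕ => (n : ℝ) ^ (-(c - a - b) - 1)) atTop).mul
    ((tendsto_gaussTerm_ratio (c := c) ha hb).isBigO_one ℝ)
  simp only [mul_one] at h1
  refine Asymptotics.IsBigO.trans ?_ h1
  refine Asymptotics.IsBigO.of_bound 1 ?_
  filter_upwards [eventually_gt_atTop 0] with n hn
  have hn' : (0 : ℝ) < n := by exact_mod_cast hn
  have h3 := gaussTerm_succ_eq ha hb (by linarith : 0 < c) n hn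
  have h4 := gaussTerm_pos ha hb (by linarith : 0 < c) (n + 1)
  rw [Real.rpow_sub hn', Real.rpow_one, div_mul_eq_mul_div, ← h3, one_mul,
    Real.norm_of_nonneg h4.le, Real.norm_of_nonneg (by positivity), le_div_iff₀ hn']
  nlinarith

lemma gaussTerm_contiguous {a b c : ℝ} (hc : 0 < c) (x : ℕ) :
    c * (c - a - b) * gaussTerm a b c x - (c - a) * (c - b) * gaussTerm a b (c + 1) x
      = c * (x * gaussTerm a b c x) - c * ((x + 1 : ℕ) * gaussTerm a b c (x + 1)) := by
  have h1 := (poch_pos hc x).ne'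
  have h2 : c + x ≠ 0 := by positivity
  have h3 : poch (c + 1) x = poch c x * (c + x) / c := by
    rw [← poch_succ, poch_succ']; field_simp
  have h4 : (x : ℝ) + 1 ≠ 0 := by positivity
  have h5 : (x.factorial : ℝ) ≠ 0 := by positivity
  simp only [gaussTerm, h3, poch_succ, Nat.factorial_succ]
  push_cast
  field_simp
  ring

lemma tsum_gaussTerm_contiguous {a b c : ℝ} (ha : 0 < a) (hb : 0 < b) (h : a + b < c) :
    c * (c - a - b) * ∑' x, gaussTerm a b c x
      = (c - a) * (c - b) * ∑' x, gaussTerm a b (c + 1) x := by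
  have h1 := (summable_gaussTerm ha hb h).hasSum.mul_left (c * (c - a - b))
  have h2 := (summable_gaussTerm ha hb (by linarith : a + b < c + 1)).hasSum.mul_left
    ((c - a) * (c - b))
  have h3 := (h1.sub h2).tendsto_sum_nat
  simp only [gaussTerm_contiguous (by linarith : 0 < c)] at h3
  have h4 : Tendsto (fun n : ℕ => c * (0 : ℕ) * gaussTerm a b c 0 - c * (n * gaussTerm a b c n))
      atTop (𝓝 (c * (0 : ℕ) * gaussTerm a b c 0 - c * 0)) :=
    ((tendsto_mul_gaussTerm ha hb h).const_mul c).const_sub _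
  have h5 := tendsto_nhds_unique h3 (h4.congr fun n => by
    rw [sum_range_sub' fun x : ℕ => c * (x * gaussTerm a b c x)]; ring)
  simp at h5
  linarith

lemma tsum_gaussTerm_add_natCast {a b c : ℝ} (ha : 0 < a) (hb : 0 < b) (h : a + b < c) (m : ℕ) :
    ∑' x, gaussTerm a b c x = poch (c - a) m * poch (c - b) m / (poch c m * poch (c - a - b) m)
      * ∑' x, gaussTerm a b (c + m) x := by
  induction m with
  | zero => simp [poch]
  | succ m ih =>
    have h1 := tsum_gaussTerm_contiguous ha hb
      (by linarith [m.cast_nonneg (α := ℝ)] : a + b < c + m)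
    have h2 := poch_pos (by linarith : 0 < c) m
    have h3 := poch_pos (by linarith : 0 < c - a - b) m
    have h4 : 0 < c + m := by linarith [m.cast_nonneg (α := ℝ)]
    have h5 : 0 < c - a - b + m := by linarith [m.cast_nonneg (α := ℝ)]
    rw [ih]
    simp only [poch_succ]
    push_cast
    rw [← add_assoc]
    field_simp
    linear_combination poch (c - a) m * poch (c - b) m * h1

lemma tendsto_poch_atTop (c : ℝ) (x : ℕ) :
    Tendsto (fun m : ℕ => poch (c + m) (x + 1)) atTop atTop := by
  have h0 : ∀ i : ℝ, Tendsto (fun m : ℕ => c + m + i) atTop atTop := fun i =>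
    tendsto_atTop_add_const_right _ _
      (tendsto_atTop_add_const_left _ _ tendsto_natCast_atTop_atTop)
  induction x with
  | zero => simpa [poch] using h0 0
  | succ x ih => simpa only [poch_succ _ (x + 1)] using ih.atTop_mul_atTop₀ (h0 _)

lemma tendsto_tsum_gaussTerm {a b c : ℝ} (ha : 0 < a) (hb : 0 < b) (h : a + b < c) :
    Tendsto (fun m : ℕ => ∑' x, gaussTerm a b (c + m) x) atTop (𝓝 1) := by
  have key := tendsto_tsum_of_dominated_convergence (𝓕 := atTop)
    (f := fun (m : ℕ) x => gaussTerm a b (c + m) x) (g := fun x => if x = 0 then (1 : ℝ) else 0)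
    (bound := gaussTerm a b c) (summable_gaussTerm ha hb h) ?_ ?_
  · simpa using key
  · rintro (_ | x)
    · simp [gaussTerm_zero]
    · have := ((tendsto_poch_atTop c x).const_mul_atTop
        (by positivity : (0 : ℝ) < (x + 1).factorial)).const_div_atTop
          (poch a (x + 1) * poch b (x + 1))
      simpa [gaussTerm] using this
  · refine Eventually.of_forall fun m x => ?_
    have hc : 0 < c := by linarith
    rw [Real.norm_of_nonneg (gaussTerm_pos ha hb (by positivity) x).le]
    have := poch_pos ha x
    have := poch_pos hb x
    have := poch_pos hc x
    unfold gaussTerm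
    gcongr
    unfold poch
    gcongr
    simp

/-- Gauss's summation theorem for positive numerator parameters. -/
theorem hasSum_gaussTerm {a b c : ℝ} (ha : 0 < a) (hb : 0 < b) (h : a + b < c) :
    HasSum (gaussTerm a b c) (Real.Gamma c * Real.Gamma (c - a - b) /
      (Real.Gamma (c - a) * Real.Gamma (c - b))) := by
  have hs := summable_gaussTerm ha hb h
  convert hs.hasSum using 1
  have hlim := (((Real.GammaSeq_tendsto_Gamma c).mul
    (Real.GammaSeq_tendsto_Gamma (c - a - b))).div
    ((Real.GammaSeq_tendsto_Gamma (c - a)).mul (Real.GammaSeq_tendsto_Gamma (c - b)))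
    (mul_pos (Real.Gamma_pos_of_pos (by linarith)) (Real.Gamma_pos_of_pos (by linarith))).ne').mul
    ((tendsto_tsum_gaussTerm ha hb h).comp (tendsto_add_atTop_nat 1))
  rw [mul_one] at hlim
  refine tendsto_nhds_unique hlim (tendsto_const_nhds.congr' ?_)
  filter_upwards [eventually_gt_atTop 0] with n hn
  have hn' : (0 : ℝ) < n := by exact_mod_cast hn
  have h1 := poch_pos (by linarith : 0 < c) (n + 1)
  have h2 := poch_pos (by linarith : 0 < c - a - b) (n + 1)
  have h3 := poch_pos (by linarith : 0 < c - a) (n + 1)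
  have h4 := poch_pos (by linarith : 0 < c - b) (n + 1)
  have h5 : (n : ℝ) ^ c * (n : ℝ) ^ (c - a - b) = (n : ℝ) ^ (c - a) * (n : ℝ) ^ (c - b) := by
    rw [← Real.rpow_add hn', ← Real.rpow_add hn']; congr 1; ring
  have h6 : (n : ℝ) ^ (c - a) * (n : ℝ) ^ (c - b) ≠ 0 := by positivity
  rw [tsum_gaussTerm_add_natCast ha hb h (n + 1), Function.comp]
  congr 1
  have h8 : ∀ s : ℝ, Real.GammaSeq s n = (n : ℝ) ^ s * n.factorial / poch s (n + 1) := fun s => rfl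
  simp only [Pi.div_apply, h8]
  have h7 : (n.factorial : ℝ) ≠ 0 := by positivity
  have e : ∀ A B C D p q r s f : ℝ, A * B = C * D → C * D ≠ 0 → p ≠ 0 → q ≠ 0 → r ≠ 0 → s ≠ 0 →
      f ≠ 0 → r * s / (p * q) = A * f / p * (B * f / q) / (C * f / r * (D * f / s)) := by
    intro A B C D p q r s f hAB hCD hp hq hr hs hf
    have hC := left_ne_zero_of_mul hCD
    have hD := right_ne_zero_of_mul hCD
    field_simp
    linear_combination -hAB
  exact e _ _ _ _ _ _ _ _ _ h5 h6 h1.ne' h2.ne' h3.ne' h4.ne' h7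

lemma prod_range_natCast_sub (k : ℕ) : ∏ j ∈ range k, ((k : ℝ) - j) = k.factorial := by
  induction k with
  | zero => simp
  | succ k ih =>
    rw [prod_range_succ', Nat.factorial_succ]
    push_cast
    simp only [add_sub_add_right_eq_sub, ih]
    ring

lemma nodalWeight_range {n k : ℕ} (h : k ≤ n) :
    Lagrange.nodalWeight (range (n + 1)) (fun i : ℕ => (i : ℝ)) k
      = (-1) ^ n * ((-1) ^ k * n.choose k) / n.factorial := by
  obtain ⟨m, rfl⟩ := Nat.exists_eq_add_of_le h
  have h1 : ∀ m : ℕ, ∏ i ∈ range m, ((k : ℝ) - (k + 1 + i : ℕ)) = (-1) ^ m * m.factorial := by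
    intro m
    induction m with
    | zero => simp
    | succ m ih => rw [prod_range_succ, ih, Nat.factorial_succ]; push_cast; ring
  have h2 : Lagrange.nodalWeight (range (k + m + 1)) (fun i : ℕ => (i : ℝ)) k
      = ∏ j ∈ range (k + 1 + m), if j = k then 1 else ((k : ℝ) - j)⁻¹ := by
    rw [Lagrange.nodalWeight, show k + 1 + m = k + m + 1 by ring,
      ← mul_prod_erase (range (k + m + 1)) _ (mem_range.2 (by omega : k < k + m + 1)), if_pos rfl,
      one_mul]
    exact prod_congr rfl fun j hj => by rw [if_neg (ne_of_mem_erase hj)]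
  rw [h2, prod_range_add, prod_range_succ, if_pos rfl, mul_one,
    prod_congr rfl fun j hj => if_neg (mem_range.1 hj).ne,
    prod_congr rfl fun j (_ : j ∈ range m) => if_neg (by omega), prod_inv_distrib,
    prod_inv_distrib, h1, prod_range_natCast_sub, Nat.cast_add_choose, pow_add]
  have h3 : ((-1 : ℝ) ^ k) * (-1) ^ k = 1 := by rw [← mul_pow]; simp
  have h4 : ((-1 : ℝ) ^ m) * (-1) ^ m = 1 := by rw [← mul_pow]; simp
  field_simp
  linear_combination -(-1 : ℝ) ^ m * (-1) ^ m * h3 - h4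

/-- Partial fraction expansion of a polynomial of degree at most `n` over `∏ (z - i)`. -/
lemma sum_choose_mul_eval_div_sub (P : Polynomial ℝ) {n : ℕ} (hP : P.natDegree ≤ n) {z : ℝ}
    (hz : ∀ i ∈ range (n + 1), z ≠ i) :
    ∑ k ∈ range (n + 1), (-1) ^ k * n.choose k * (P.eval (k : ℝ) / (z - k))
      = (-1) ^ n * n.factorial * P.eval z / ∏ i ∈ range (n + 1), (z - i) := by
  have hd : P.degree < #(range (n + 1)) := by
    rw [card_range]
    exact (Polynomial.degree_le_of_natDegree_le hP).trans_lt (by exact_mod_cast n.lt_succ_self)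
  have h1 := Lagrange.eval_interpolate_not_at_node (s := range (n + 1)) (x := z)
    (v := fun i : ℕ => (i : ℝ)) (fun i => P.eval (i : ℝ)) hz
  rw [← Lagrange.eq_interpolate (Nat.cast_injective.injOn) hd, Lagrange.eval_nodal] at h1
  have h2 : ∏ i ∈ range (n + 1), (z - i) ≠ 0 :=
    prod_ne_zero_iff.2 fun i hi => sub_ne_zero.2 (hz i hi)
  have h3 : ((-1 : ℝ) ^ n) * (-1) ^ n = 1 := by rw [← mul_pow]; simp
  have h4 : (n.factorial : ℝ) ≠ 0 := by positivity
  rw [h1, mul_left_comm, mul_div_cancel_left₀ _ h2, mul_sum]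
  refine sum_congr rfl fun k hk => ?_
  rw [nodalWeight_range (by simpa [Nat.lt_succ_iff] using hk)]
  have h5 : z - k ≠ 0 := sub_ne_zero.2 (hz k hk)
  field_simp
  linear_combination -((n.choose k : ℝ) * P.eval (k : ℝ)) * h3

lemma Gamma_add_one_eq_mul_prod {z : ℝ} {k : ℕ} (h : (k : ℝ) < z + 1) :
    Real.Gamma (z + 1) = Real.Gamma (z + 1 - k) * ∏ i ∈ range k, (z - i) := by
  induction k with
  | zero => simp
  | succ k ih =>
    push_cast at h ⊢
    rw [ih (by linarith), prod_range_succ, show z + 1 - k = z - k + 1 by ring,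
      Real.Gamma_add_one (by linarith), show z + 1 - (k + 1) = z - k by ring]
    ring

lemma HasSum.of_eq {f g : ℕ → ℝ} {s t : ℝ} (h : HasSum g t) (hf : ∀ x, f x = g x) (hs : s = t) :
    HasSum f s := by
  rwa [funext hf, hs]

lemma hasSum_poch_neg_mul_poch_mul_gaussTerm {a b c : ℝ} (ha : 0 < a) (hb : 0 < b) (k j : ℕ)
    (h : a + b + k + j < c) :
    HasSum (fun x : ℕ => poch (-(x : ℝ)) k * poch (a + x) j * gaussTerm a b c x)
      ((-1) ^ k * poch a (k + j) * poch b k * (Real.Gamma c * Real.Gamma (c - a - b - k - j) /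
        (Real.Gamma (c - a - j) * Real.Gamma (c - b)))) := by
  have hk : (0 : ℝ) ≤ k := k.cast_nonneg
  have hj : (0 : ℝ) ≤ j := j.cast_nonneg
  have hc : 0 < c := by linarith
  rw [← (add_left_injective k).hasSum_iff]
  · have h1 := (hasSum_gaussTerm (a := a + (k + j : ℕ)) (b := b + k) (c := c + k)
      (by positivity) (by positivity) (by push_cast; linarith)).mul_left
      ((-1) ^ k * poch a (k + j) * poch b k / poch c k)
    have h2 := (poch_pos hc k).ne'
    refine h1.of_eq (fun x => ?_) ?_
    · have e1 : poch a (x + k) * poch (a + (x + k : ℕ)) j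
          = poch a (k + j) * poch (a + (k + j : ℕ)) x := by
        rw [← poch_add, ← poch_add]; congr 1; ring
      have e2 : poch b (x + k) = poch b k * poch (b + k) x := by rw [← poch_add, add_comm]
      have e3 : poch c (x + k) = poch c k * poch (c + k) x := by rw [← poch_add, add_comm]
      have h3 := (poch_pos (by positivity : 0 < c + k) x).ne'
      simp only [Function.comp, gaussTerm, poch_neg_natCast_add, e2, e3]
      field_simp
      linear_combination poch b k * poch (b + k) x * e1
    · rw [Gamma_add_natCast hc]
      push_cast
      rw [show c + k - (a + (k + j)) - (b + k) = c - a - b - k - j by ring,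
        show c + k - (a + (k + j)) = c - a - j by ring, show c + k - (b + k) = c - b by ring]
      field_simp
  · intro x hx
    have : x < k := by
      by_contra! hkx
      exact hx ⟨x - k, Nat.sub_add_cancel hkx⟩
    simp [poch_neg_natCast_of_lt this]

/-- The coefficients of `Rpol` in the basis `(-x)_k`, with shifted parameters. -/
noncomputable def hahnCoeff (a b c : ℝ) (n k : ℕ) : ℝ :=
  poch (-(n : ℝ)) k * poch (n + a + b - c) k / (poch a k * poch b k * k.factorial)

/-- The polynomial `Rpol`, with shifted parameters. -/
noncomputable def hahn (a b c : ℝ) (n : ℕ) (x : ℝ) : ℝ :=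
  ∑ k ∈ range (n + 1), hahnCoeff a b c n k * poch (-x) k

/-- The pairing of `hahn a b c n` with a monic polynomial of degree `n`. -/
noncomputable def hahnMoment (a b c : ℝ) (n : ℕ) : ℝ :=
  Real.Gamma c * Real.Gamma (c - a - b - n + 1) /
      (Real.Gamma (c - a - n) * Real.Gamma (c - b - n)) *
    ((-1) ^ n * n.factorial / ∏ i ∈ range (n + 1), (c - a - b - n - i))

lemma sum_hahnCoeff_mul {a b c : ℝ} (ha : 0 < a) (hb : 0 < b) {n j : ℕ} (hj : j ≤ n)
    (h : a + b + 2 * n < c) :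
    ∑ k ∈ range (n + 1), hahnCoeff a b c n k *
      ((-1) ^ k * poch a (k + j) * poch b k * (Real.Gamma c * Real.Gamma (c - a - b - k - j) /
        (Real.Gamma (c - a - j) * Real.Gamma (c - b))))
      = if j = n then hahnMoment a b c n else 0 := by
  have hn : (0 : ℝ) ≤ n := n.cast_nonneg
  obtain ⟨z, hz⟩ : ∃ z, z = c - a - b - n := ⟨_, rfl⟩
  have hzn : (n : ℝ) < z := by linarith
  obtain ⟨P, hP⟩ : ∃ P : Polynomial ℝ, P = (∏ i ∈ range j, (Polynomial.X + Polynomial.C (a + i))) *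
    ∏ i ∈ range (n - j), (Polynomial.C (z + i) - Polynomial.X) := ⟨_, rfl⟩
  have hdeg : P.natDegree ≤ n := by
    have h1 : (∏ i ∈ range j, (Polynomial.X + Polynomial.C (a + i))).natDegree ≤ j := by
      refine (Polynomial.natDegree_prod_le _ _).trans ?_
      simp only [Polynomial.natDegree_X_add_C]
      simp
    have h2 : (∏ i ∈ range (n - j), (Polynomial.C (z + i) - Polynomial.X)).natDegree ≤ n - j := by
      refine (Polynomial.natDegree_prod_le _ _).trans
        ((sum_le_card_nsmul _ _ 1 fun i _ => ?_).trans (by simp))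
      exact (Polynomial.natDegree_sub_le _ _).trans (by simp)
    rw [hP]
    exact Polynomial.natDegree_mul_le.trans (by omega)
  have heval : ∀ x, P.eval x = poch (a + x) j * poch (z - x) (n - j) := by
    intro x
    rw [hP, Polynomial.eval_mul, Polynomial.eval_prod, Polynomial.eval_prod, poch, poch]
    congr 1 <;> refine prod_congr rfl fun i _ => ?_ <;> simp <;> ring
  have hlt : ∀ i ∈ range (n + 1), (i : ℝ) < z := fun i hi =>
    lt_of_le_of_lt (by exact_mod_cast Nat.lt_succ_iff.1 (mem_range.1 hi)) hzn
  have hterm : ∀ k ∈ range (n + 1), hahnCoeff a b c n k *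
      ((-1) ^ k * poch a (k + j) * poch b k * (Real.Gamma c * Real.Gamma (c - a - b - k - j) /
        (Real.Gamma (c - a - j) * Real.Gamma (c - b))))
      = Real.Gamma c * Real.Gamma (z + 1) / (Real.Gamma (c - a - j) * Real.Gamma (c - b)) *
        ((-1) ^ k * n.choose k * (P.eval (k : ℝ) / (z - k))) := by
    intro k hk
    have hkz := hlt k hk
    have e1 : Real.Gamma (c - a - b - k - j) = Real.Gamma (z - k) * poch (z - k) (n - j) := by
      rw [← Gamma_add_natCast (by linarith), Nat.cast_sub hj, hz]; congr 1; ring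
    have e2 : Real.Gamma (z + 1) = (z - k) * Real.Gamma (z - k) * ∏ i ∈ range k, (z - i) := by
      rw [Gamma_add_one_eq_mul_prod (k := k) (by linarith), ← Real.Gamma_add_one (by linarith)]
      congr 2; ring
    have e3 : poch (n + a + b - c) k = (-1) ^ k * ∏ i ∈ range k, (z - i) := by
      rw [← poch_neg, hz]; congr 1; ring
    have h1 := (poch_pos ha k).ne'
    have h2 := (poch_pos hb k).ne'
    have h3 : z - k ≠ 0 := by linarith
    have h5 := (Real.Gamma_pos_of_pos (by linarith : 0 < c - b)).ne'
    have hjn : (j : ℝ) ≤ n := by exact_mod_cast hj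
    have h6 := (Real.Gamma_pos_of_pos (by linarith : 0 < c - a - j)).ne'
    rw [hahnCoeff, poch_neg_natCast (Nat.lt_succ_iff.1 (mem_range.1 hk)), e1, e2, e3, heval,
      poch_add]
    have h7 : (k.factorial : ℝ) ≠ 0 := by positivity
    field_simp
    rw [pow_right_comm]
    ring
  rw [sum_congr rfl hterm, ← mul_sum,
    sum_choose_mul_eval_div_sub P hdeg fun i hi => (hlt i hi).ne', heval]
  split_ifs with hjn
  · subst hjn
    have e4 : Real.Gamma (c - b) = Real.Gamma (c - b - j) * poch (c - b - j) j := by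
      rw [← Gamma_add_natCast (by linarith)]; congr 1; ring
    have h8 := (poch_pos (by linarith : 0 < c - b - j) j).ne'
    rw [hahnMoment, e4, Nat.sub_self, poch_zero, mul_one, ← hz,
      show a + z = c - b - j by rw [hz]; ring]
    field_simp
  · obtain ⟨m, hm⟩ : ∃ m, n - j = m + 1 := ⟨n - j - 1, by omega⟩
    rw [hm, poch_succ', sub_self]
    simp

lemma hasSum_hahn_mul_poch {a b c : ℝ} (ha : 0 < a) (hb : 0 < b) {n j : ℕ} (hj : j ≤ n)
    (h : a + b + 2 * n < c) :
    HasSum (fun x : ℕ => hahn a b c n x * poch (a + x) j * gaussTerm a b c x)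
      (if j = n then hahnMoment a b c n else 0) := by
  rw [← sum_hahnCoeff_mul ha hb hj h]
  have hs := hasSum_sum (s := range (n + 1)) fun k hk =>
    (hasSum_poch_neg_mul_poch_mul_gaussTerm (c := c) ha hb k j (by
      have h1 : (k : ℝ) ≤ n := by exact_mod_cast Nat.lt_succ_iff.1 (mem_range.1 hk)
      have h2 : (j : ℝ) ≤ n := by exact_mod_cast hj
      linarith)).mul_left (hahnCoeff a b c n k)
  refine hs.congr_fun fun x => ?_
  simp only [hahn, sum_mul, mul_assoc]

lemma hasSum_hahn_mul_poch_neg_mul_poch {a b c : ℝ} (ha : 0 < a) (hb : 0 < b) {n : ℕ}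
    (h : a + b + 2 * n < c) (k : ℕ) : ∀ j, k + j ≤ n →
    HasSum (fun x : ℕ => hahn a b c n x * (poch (-(x : ℝ)) k * poch (a + x) j) * gaussTerm a b c x)
      (if k + j = n then (-1) ^ k * hahnMoment a b c n else 0) := by
  induction k with
  | zero =>
    intro j hj
    simpa [poch_zero] using hasSum_hahn_mul_poch ha hb (by omega : j ≤ n) h
  | succ k ih =>
    intro j hj
    have h1 := ((ih j (by omega)).mul_left (a + j + k)).sub (ih (j + 1) (by omega))
    rw [if_neg (by omega), mul_zero, zero_sub] at h1
    refine h1.of_eq (fun x => ?_) ?_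
    · rw [poch_succ, poch_succ]; ring
    · rw [show k + 1 + j = k + (j + 1) by ring, pow_succ]
      split_ifs <;> ring

/-- The squared norm of `hahn a b c n` with respect to `gaussTerm a b c`. -/
theorem hasSum_hahn_sq {a b c : ℝ} (ha : 0 < a) (hb : 0 < b) {n : ℕ} (h : a + b + 2 * n < c) :
    HasSum (fun x : ℕ => hahn a b c n x ^ 2 * gaussTerm a b c x)
      (n.factorial / ((c - a - b - 2 * n) * poch a n * poch b n) *
        (Real.Gamma (c - a - b - n + 1) * Real.Gamma c /
          (Real.Gamma (c - a - n) * Real.Gamma (c - b - n)))) := by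
  have hs := hasSum_sum (s := range (n + 1)) fun k hk =>
    (hasSum_hahn_mul_poch_neg_mul_poch ha hb h k 0
      (Nat.lt_succ_iff.1 (mem_range.1 hk))).mul_left (hahnCoeff a b c n k)
  refine hs.of_eq (fun x => ?_) ?_
  · rw [sq]
    nth_rewrite 2 [hahn]
    rw [mul_sum, sum_mul]
    refine sum_congr rfl fun k _ => ?_
    rw [poch_zero]; ring
  · have hn : (0 : ℝ) ≤ n := n.cast_nonneg
    have e3 : poch (n + a + b - c) n = (-1) ^ n * ∏ i ∈ range n, (c - a - b - n - i) := by
      rw [← poch_neg]; congr 1; ring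
    have h0 : ∏ i ∈ range n, (c - a - b - n - i) ≠ 0 := by
      refine prod_ne_zero_iff.2 fun i hi => ?_
      have : (i : ℝ) < n := by exact_mod_cast mem_range.1 hi
      linarith
    have h1 := (poch_pos ha n).ne'
    have h2 := (poch_pos hb n).ne'
    have h3 : c - a - b - 2 * n ≠ 0 := by linarith
    have h5 := (Real.Gamma_pos_of_pos (by linarith : 0 < c - b - n)).ne'
    have h6 := (Real.Gamma_pos_of_pos (by linarith : 0 < c - a - n)).ne'
    have h7 : (n.factorial : ℝ) ≠ 0 := by positivity
    simp only [add_zero, mul_ite, mul_zero, sum_ite_eq', mem_range, Nat.lt_succ_self, if_true]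
    rw [hahnCoeff, hahnMoment, poch_neg_natCast le_rfl, e3, prod_range_succ,
      show c - a - b - n - n = c - a - b - 2 * n by ring, Nat.choose_self]
    have e5 : ((-1 : ℝ) ^ n) ^ 4 = 1 := by rw [← pow_mul, mul_comm, pow_mul]; norm_num
    push_cast
    field_simp
    linear_combination -(Real.Gamma (c - a - b - n + 1) * Real.Gamma c) * e5

/-- Proposition 4.3: the norm of `R_n`,
`⟨R_n, R_n⟩ = n!/((α₃−α₁−α₂−2n−1)(1+α₁)_n(1+α₂)_n)
    · Γ(α₃−α₁−α₂−n)Γ(α₃+1)/(Γ(α₃−α₁−n)Γ(α₃−α₂−n))`. -/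
theorem Rpol_norm (α₁ α₂ α₃ : ℝ)
    (hα₃ : 0 < α₃) (hα₁ : -1 < α₁) (hα₂ : -1 < α₂)
    (n : ℕ) (hn : 2 * (n : ℝ) < α₃ - α₁ - α₂ - 1) :
    Summable (fun x : ℕ => Rpol α₁ α₂ α₃ n x ^ 2 * Wt α₁ α₂ α₃ x)
    ∧ ∑' x : ℕ, Rpol α₁ α₂ α₃ n x ^ 2 * Wt α₁ α₂ α₃ x
      = (Nat.factorial n : ℝ)
          / ((α₃ - α₁ - α₂ - 2 * (n : ℝ) - 1) * poch (1 + α₁) n * poch (1 + α₂) n)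
        * (Real.Gamma (α₃ - α₁ - α₂ - (n : ℝ)) * Real.Gamma (α₃ + 1)
          / (Real.Gamma (α₃ - α₁ - (n : ℝ)) * Real.Gamma (α₃ - α₂ - (n : ℝ)))) := by
  have hs := hasSum_hahn_sq (a := α₁ + 1) (b := α₂ + 1) (c := α₃ + 1) (by linarith)
    (by linarith) (n := n) (by linarith)
  have hR : ∀ x : ℝ, hahn (α₁ + 1) (α₂ + 1) (α₃ + 1) n x = Rpol α₁ α₂ α₃ n x := by
    intro x
    refine sum_congr rfl fun k _ => ?_
    rw [hahnCoeff, show (n : ℝ) + (α₁ + 1) + (α₂ + 1) - (α₃ + 1) = n - α₃ + α₁ + α₂ + 1 by ring]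
    field_simp
  simp only [hR] at hs
  refine ⟨hs.summable, hs.tsum_eq.trans ?_⟩
  rw [show α₃ + 1 - (α₁ + 1) - (α₂ + 1) - 2 * (n : ℝ) = α₃ - α₁ - α₂ - 2 * n - 1 by ring,
    show α₃ + 1 - (α₁ + 1) - (α₂ + 1) - (n : ℝ) + 1 = α₃ - α₁ - α₂ - n by ring,
    show α₃ + 1 - (α₁ + 1) - (n : ℝ) = α₃ - α₁ - n by ring,
    show α₃ + 1 - (α₂ + 1) - (n : ℝ) = α₃ - α₂ - n by ring, add_comm 1 α₁, add_comm 1 α₂]
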